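/- Let p and q be odd primes with p dividing q−1, let G be a finite non-abelian group of order pq, and let S be a minimal product-one sequence over G with |S| ≥ 2q + 1. Then for every subgroup H ≤ G with |H| = p, the number of terms of S lying in H is at most q. -/

import Mathlib

/-- The set of all products of the terms of the multiset `S` taken in some order. -/
def prodSet {G : Type*} [Group G] (S : Multiset G) : Set G :=
  {g | ∃ l : List G, (l : Multiset G) = S ∧ l.prod = g}

/-- A sequence (multiset) over `G` is a product-one sequence if its terms can be
ordered so that their product is `1`. -/
def IsProductOne {G : Type*} [Group G] (S : Multiset G) : Prop :=
  (1 : G) ∈ prodSet S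

/-- A minimal product-one sequence (atom): a nontrivial product-one sequence that cannot
be partitioned into two nontrivial product-one subsequences. -/
def IsMinimalProductOne {G : Type*} [Group G] (S : Multiset G) : Prop :=
  S ≠ 0 ∧ IsProductOne S ∧
    ¬ ∃ T₁ T₂ : Multiset G, T₁ ≠ 0 ∧ T₂ ≠ 0 ∧ S = T₁ + T₂ ∧
      IsProductOne T₁ ∧ IsProductOne T₂

/-- The small Davenport constant: the maximal length of a sequence over `G` having
no nontrivial product-one subsequence. -/
noncomputable def smallDavenport (G : Type*) [Group G] : ℕ :=
  sSup {n | ∃ S : Multiset G, Multiset.card S = n ∧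
    ∀ T : Multiset G, T ≤ S → T ≠ 0 → ¬ IsProductOne T}

/-- The large Davenport constant: the maximal length of a minimal product-one sequence. -/
noncomputable def largeDavenport (G : Type*) [Group G] : ℕ :=
  sSup {n | ∃ S : Multiset G, Multiset.card S = n ∧ IsMinimalProductOne S}

open Pointwise in
/-- The **Cauchy-Davenport theorem** inside a subgroup of prime order. -/
lemma Subgroup.min_card_le_ncard_mul {G : Type*} [Group G] [Finite G] {K : Subgroup G}
    (hK : (Nat.card K).Prime) {A B : Set G} (hA : A ⊆ K) (hB : B ⊆ K)
    (hA' : A.Nonempty) (hB' : B.Nonempty) :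
    min (Nat.card K) (A.ncard + B.ncard - 1) ≤ (A * B).ncard := by
  classical
  have hmin : (Nat.card K : ℕ∞) ≤ Monoid.minOrder K := by
    rw [Monoid.le_minOrder]
    intro a ha _
    have h := (Nat.dvd_prime hK).1 (_root_.orderOf_dvd_natCard a)
    rw [orderOf_eq_one_iff] at h
    rw [h.resolve_left ha]
  have key : ∀ C : Set G, C ⊆ K → ∃ s : Finset K, Subtype.val '' (s : Set K) = C := fun C hC ↦
    ⟨(Set.toFinite (Subtype.val ⁻¹' C)).toFinset, by
      rw [Set.Finite.coe_toFinset]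
      exact Subtype.image_preimage_val .. |>.trans (Set.inter_eq_right.2 hC)⟩
  obtain ⟨s, rfl⟩ := key A hA
  obtain ⟨t, rfl⟩ := key B hB
  have h := cauchy_davenport_minOrder_mul (s := s) (t := t) (by simpa using hA')
    (by simpa using hB')
  have h₁ : (min (Nat.card K) (s.card + t.card - 1) : ℕ) ≤ (s * t).card := by
    have := (min_le_min_right _ hmin).trans h
    rw [← Nat.cast_le (α := ℕ∞), Nat.mono_cast.map_min]
    exact this
  have hinj : Function.Injective (Subtype.val : K → G) := Subtype.val_injective
  have hmul : (Subtype.val '' (s : Set K) : Set G) * Subtype.val '' (t : Set K)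
      = Subtype.val '' ((s * t : Finset K) : Set K) := by
    rw [Finset.coe_mul]
    exact (Set.image_mul K.subtype).symm
  rw [hmul, Set.ncard_image_of_injective _ hinj, Set.ncard_image_of_injective _ hinj,
    Set.ncard_image_of_injective _ hinj]
  simpa only [Set.ncard_coe_finset] using h₁

section ProdSet

variable {G : Type*} [Group G]

lemma prodSet_nonempty (S : Multiset G) : (prodSet S).Nonempty :=
  ⟨S.toList.prod, S.toList, S.coe_toList, rfl⟩

lemma mul_mem_prodSet {S T : Multiset G} {a b : G} (ha : a ∈ prodSet S) (hb : b ∈ prodSet T) :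
    a * b ∈ prodSet (S + T) := by
  obtain ⟨l, rfl, rfl⟩ := ha
  obtain ⟨l', rfl, rfl⟩ := hb
  exact ⟨l ++ l', by simp, by simp⟩

lemma mem_prodSet_singleton (a : G) : a ∈ prodSet {a} := ⟨[a], by simp, by simp⟩

lemma mul_mem_prodSet_cons {S : Multiset G} {a b : G} (hb : b ∈ prodSet S) :
    a * b ∈ prodSet (a ::ₘ S) :=
  mul_mem_prodSet (mem_prodSet_singleton a) hb

lemma mul_mem_prodSet_cons' {S : Multiset G} {a b : G} (hb : b ∈ prodSet S) :
    b * a ∈ prodSet (a ::ₘ S) := by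
  rw [← Multiset.singleton_add, add_comm]
  exact mul_mem_prodSet hb (mem_prodSet_singleton a)

lemma map_eq_of_mem_prodSet {M : Type*} [CommGroup M] (φ : G →* M) {S : Multiset G} {a : G}
    (ha : a ∈ prodSet S) : φ a = (S.map φ).prod := by
  obtain ⟨l, rfl, rfl⟩ := ha
  simpa using map_list_prod φ l

lemma map_prod_eq_one {M : Type*} [CommGroup M] (φ : G →* M) {S : Multiset G}
    (hS : IsProductOne S) : (S.map φ).prod = 1 := by
  rw [← map_eq_of_mem_prodSet φ hS, map_one]

lemma IsMinimalProductOne.one_notMem {S : Multiset G} (hS : IsMinimalProductOne S)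
    (hcard : 1 < S.card) : (1 : G) ∉ S := by
  intro h1
  obtain ⟨-, ⟨l, rfl, hl⟩, hmin⟩ := hS
  obtain ⟨s, t, rfl⟩ := List.append_of_mem (Multiset.mem_coe.1 h1)
  refine hmin ⟨{1}, ↑(s ++ t), by simp, ?_, ?_, ⟨[1], by simp, by simp⟩, s ++ t, rfl, ?_⟩
  · rw [← Multiset.card_pos]
    simp only [Multiset.coe_card, List.length_append, List.length_cons] at hcard ⊢
    omega
  · rw [Multiset.singleton_add, Multiset.cons_coe, Multiset.coe_eq_coe]
    exact List.perm_middle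
  · simpa using hl

/-- The terms of `S` have at least `k + 1` products, or all the products allowed by the order `q`
of the commutator subgroup. -/
def HasManyProducts (q : ℕ) (S : Multiset G) (k : ℕ) : Prop :=
  min q (k + 1) ≤ (prodSet S).ncard

variable [Finite G]

lemma HasManyProducts.zero (q : ℕ) (S : Multiset G) : HasManyProducts q S 0 :=
  (min_le_right _ _).trans ((Set.ncard_pos).2 (prodSet_nonempty S))

variable {M : Type*} [CommGroup M] {φ : G →* M}

open Pointwise in
lemma HasManyProducts.add (hφ : (Nat.card φ.ker).Prime) {S T : Multiset G} {a b : ℕ}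
    (hS : HasManyProducts (Nat.card φ.ker) S a) (hT : HasManyProducts (Nat.card φ.ker) T b) :
    HasManyProducts (Nat.card φ.ker) (S + T) (a + b) := by
  obtain ⟨x, hx⟩ := prodSet_nonempty S
  obtain ⟨y, hy⟩ := prodSet_nonempty T
  have h := Subgroup.min_card_le_ncard_mul hφ
    (A := (x⁻¹ * ·) '' prodSet S) (B := (· * y⁻¹) '' prodSet T)
    (by
      rintro _ ⟨z, hz, rfl⟩
      simp [MonoidHom.mem_ker, map_eq_of_mem_prodSet φ hx, map_eq_of_mem_prodSet φ hz])
    (by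
      rintro _ ⟨z, hz, rfl⟩
      simp [MonoidHom.mem_ker, map_eq_of_mem_prodSet φ hy, map_eq_of_mem_prodSet φ hz])
    ⟨_, x, hx, rfl⟩ ⟨_, y, hy, rfl⟩
  rw [Set.ncard_image_of_injective _ (mul_right_injective _),
    Set.ncard_image_of_injective _ (mul_left_injective _)] at h
  have hsub : (fun z ↦ x * z * y) '' ((x⁻¹ * ·) '' prodSet S * (· * y⁻¹) '' prodSet T) ⊆
      prodSet (S + T) := by
    rintro _ ⟨_, ⟨_, ⟨u, hu, rfl⟩, _, ⟨v, hv, rfl⟩, rfl⟩, rfl⟩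
    simpa [mul_assoc] using mul_mem_prodSet hu hv
  have hinj : Function.Injective fun z ↦ x * z * y :=
    (mul_left_injective y).comp (mul_right_injective x)
  have h' := Set.ncard_le_ncard hsub
  rw [Set.ncard_image_of_injective _ hinj] at h'
  unfold HasManyProducts at *
  omega

lemma HasManyProducts.isProductOne {S : Multiset G}
    (hS : HasManyProducts (Nat.card φ.ker) S (Nat.card φ.ker - 1)) (hS' : (S.map φ).prod = 1) :
    IsProductOne S := by
  have hsub : prodSet S ⊆ φ.ker := fun a ha ↦ by
    simp [MonoidHom.mem_ker, map_eq_of_mem_prodSet φ ha, hS']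
  have hle : (φ.ker : Set G).ncard ≤ (prodSet S).ncard := by
    unfold HasManyProducts at hS
    change Nat.card φ.ker ≤ _
    omega
  have := Set.eq_of_subset_of_ncard_le hsub hle
  unfold IsProductOne
  rw [this]
  exact φ.ker.one_mem

variable {H : Subgroup G}

/-- A term outside `H` together with `k < |H|` nontrivial terms of `H` has `k + 1` products. -/
lemma hasManyProducts_cons (hH : (Nat.card H).Prime)
    (hcen : ∀ h ∈ H, h ≠ 1 → ∀ g, g * h = h * g → g ∈ H)
    (hcomm : ∀ a ∈ H, ∀ b ∈ H, a * b = b * a) (q : ℕ) {g : G} (hg : g ∉ H) (C : Multiset G)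
    (hC : ∀ h ∈ C, h ∈ H ∧ h ≠ 1) (hcard : C.card + 1 ≤ Nat.card H) :
    HasManyProducts q (g ::ₘ C) C.card := by
  have key : ∃ A : Set G, A ⊆ H ∧ C.card + 1 ≤ A.ncard ∧ ∃ c ∈ H, ∀ u ∈ A,
      u * g * u⁻¹ * c ∈ prodSet (g ::ₘ C) := by
    induction C using Multiset.induction_on with
    | empty => exact ⟨{1}, by simp, by simp, 1, H.one_mem, by simpa using mem_prodSet_singleton g⟩
    | cons h C ih =>
      obtain ⟨A, hA, hAc, c, hc, hmem⟩ := ih (fun x hx ↦ hC x (Multiset.mem_cons_of_mem hx))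
        (by rw [Multiset.card_cons] at hcard; omega)
      obtain ⟨hh, hh1⟩ := hC h (Multiset.mem_cons_self h C)
      have hne : A.Nonempty := by
        rw [← Set.ncard_pos]
        omega
      open Pointwise in
      refine ⟨{1, h} * A, ?_, ?_, h * c, H.mul_mem hh hc, ?_⟩
      · rintro _ ⟨x, rfl | rfl, y, hy, rfl⟩
        · exact H.mul_mem H.one_mem (hA hy)
        · exact H.mul_mem hh (hA hy)
      · have := Subgroup.min_card_le_ncard_mul hH (A := {1, h}) (B := A)
          (by simp [Set.insert_subset_iff, hh]) hA (by simp) hne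
        rw [Set.ncard_pair hh1.symm] at this
        rw [Multiset.card_cons] at hcard ⊢
        omega
      · rw [Multiset.cons_swap]
        rintro _ ⟨x, rfl | rfl, y, hy, rfl⟩
        · have := mul_mem_prodSet_cons' (a := h) (hmem y hy)
          simpa [mul_assoc, hcomm h hh c hc] using this
        · have := mul_mem_prodSet_cons (a := x) (hmem y hy)
          simpa [mul_assoc] using this
  obtain ⟨A, hA, hAc, c, -, hmem⟩ := key
  refine (min_le_right _ _).trans (hAc.trans ?_)
  refine Set.ncard_le_ncard_of_injOn (fun u ↦ u * g * u⁻¹ * c) hmem ?_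
  intro u hu v hv huv
  by_contra hne
  refine hg (hcen (v⁻¹ * u) (H.mul_mem (H.inv_mem (hA hv)) (hA hu)) ?_ g ?_)
  · exact fun e ↦ hne (inv_mul_eq_one.1 e).symm
  · have := mul_right_cancel huv
    rw [mul_inv_eq_iff_eq_mul] at this
    rw [mul_assoc v⁻¹ u g, this]
    group

lemma hasManyProducts_triple (hcen : ∀ h ∈ H, h ≠ 1 → ∀ g, g * h = h * g → g ∈ H)
    (hinj : ∀ h ∈ H, φ h = 1 → h = 1) (q : ℕ) {a b h : G} (ha : a ∉ H) (hb : b ∉ H)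
    (hab : a * b ≠ 1) (hh : h ∈ H) (hh1 : h ≠ 1) :
    HasManyProducts q {a, b, h} 2 := by
  have key : ∀ x y : G, x ∉ H → y ∉ H → x * y ∉ H → HasManyProducts q {x, y, h} 2 := by
    intro x y hx hy hxy
    have hsub : {x * y * h, x * h * y, h * x * y} ⊆ prodSet {x, y, h} := by
      rintro _ (rfl | rfl | rfl)
      · exact ⟨[x, y, h], rfl, by simp [mul_assoc]⟩
      · exact ⟨[x, h, y], Multiset.coe_eq_coe.2 (by
          exact (List.Perm.swap _ _ _).cons _), by simp [mul_assoc]⟩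
      · exact ⟨[h, x, y], Multiset.coe_eq_coe.2 (by
          exact (List.Perm.swap _ _ _).trans ((List.Perm.swap _ _ _).cons _)),
          by simp [mul_assoc]⟩
    refine (min_le_right _ _).trans (le_trans (le_of_eq ?_) (Set.ncard_le_ncard hsub))
    refine (Set.ncard_eq_three.2 ⟨_, _, _, ?_, ?_, ?_, rfl⟩).symm
    · intro e
      exact hy (hcen h hh hh1 y (by simpa [mul_assoc] using e))
    · intro e
      exact hxy (hcen h hh hh1 _ (by simpa [mul_assoc] using e))
    · intro e
      exact hx (hcen h hh hh1 x (mul_right_cancel e))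
  by_cases h₁ : a * b ∈ H
  · by_cases h₂ : b * a ∈ H
    · refine absurd (hcen _ h₁ hab a ?_) ha
      have : a * b = b * a := by
        rw [← mul_inv_eq_one]
        exact hinj _ (H.mul_mem h₁ (H.inv_mem h₂)) (by
        rw [map_mul, map_inv, map_mul, map_mul, mul_comm (φ b), mul_inv_cancel])
      rw [mul_assoc, ← this]
    · have := key b a hb ha h₂
      rwa [show ({b, a, h} : Multiset G) = {a, b, h} from Multiset.cons_swap _ _ _] at this
  · exact key a b ha hb h₁

lemma Multiset.exists_eq_add_of_le_card {α : Type*} {K : Multiset α} {k : ℕ} (h : k ≤ K.card) :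
    ∃ C K', K = C + K' ∧ C.card = k := by
  induction K using Quotient.inductionOn with
  | h l => exact ⟨l.take k, l.drop k, by simp, by simpa using h⟩

lemma hasManyProducts_of_le_mul (hφ : (Nat.card φ.ker).Prime) (hH : (Nat.card H).Prime)
    (hcen : ∀ h ∈ H, h ≠ 1 → ∀ g, g * h = h * g → g ∈ H)
    (hcomm : ∀ a ∈ H, ∀ b ∈ H, a * b = b * a) {T : Multiset G} (hT : ∀ g ∈ T, g ∉ H)
    {K : Multiset G} (hK : ∀ h ∈ K, h ∈ H ∧ h ≠ 1) {n : ℕ} (hn : n ≤ K.card)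
    (hn' : n ≤ T.card * (Nat.card H - 1)) :
    HasManyProducts (Nat.card φ.ker) (T + K) n := by
  induction T using Multiset.induction_on generalizing K n with
  | empty =>
    obtain rfl : n = 0 := by simpa using hn'
    exact .zero _ _
  | cons g T ih =>
    obtain ⟨C, K', rfl, hC⟩ := Multiset.exists_eq_add_of_le_card
      ((min_le_left n (Nat.card H - 1)).trans hn)
    rw [Multiset.card_add] at hn
    rw [Multiset.card_cons, add_mul, one_mul] at hn'
    have h₁ := hH.two_le
    have := (hasManyProducts_cons hH hcen hcomm (Nat.card φ.ker) (hT g (Multiset.mem_cons_self _ _))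
      C (fun h hh ↦ hK h (by simp [hh])) (by omega)).add hφ
      (ih (K := K') (n := n - C.card) (fun x hx ↦ hT x (Multiset.mem_cons_of_mem hx))
        (fun h hh ↦ hK h (by simp [hh])) (by omega) (by omega))
    rwa [show C.card + (n - C.card) = n by omega,
      show g ::ₘ C + (T + K') = g ::ₘ T + (C + K') by
        simp only [← Multiset.singleton_add]; abel] at this

lemma hasManyProducts_of_triples (hφ : (Nat.card φ.ker).Prime) (hH : (Nat.card H).Prime)
    (hH3 : 3 ≤ Nat.card H) (hcen : ∀ h ∈ H, h ≠ 1 → ∀ g, g * h = h * g → g ∈ H)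
    (hcomm : ∀ a ∈ H, ∀ b ∈ H, a * b = b * a) (hinj : ∀ h ∈ H, φ h = 1 → h = 1)
    {T : Multiset G} (hT : ∀ g ∈ T, g ∉ H) (hT' : ∀ a b, {a, b} ≤ T → a * b ≠ 1)
    {K : Multiset G} (hK : ∀ h ∈ K, h ∈ H ∧ h ≠ 1) {m n : ℕ} (h₁ : m + 2 * n ≤ T.card)
    (h₂ : 2 * m + n ≤ K.card) :
    HasManyProducts (Nat.card φ.ker) (T + K) (2 * (m + n)) := by
  induction m generalizing T K with
  | zero =>
    induction n generalizing T K with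
    | zero => exact .zero _ _
    | succ n ih =>
      obtain ⟨C, T', rfl, hC⟩ := Multiset.exists_eq_add_of_le_card (K := T) (k := 2) (by omega)
      obtain ⟨D, K', rfl, hD⟩ := Multiset.exists_eq_add_of_le_card (K := K) (k := 1) (by omega)
      obtain ⟨a, b, rfl⟩ := Multiset.card_eq_two.1 hC
      obtain ⟨h, rfl⟩ := Multiset.card_eq_one.1 hD
      simp only [Multiset.card_add, hC, hD] at h₁ h₂
      obtain ⟨hh, hh1⟩ := hK h (by simp)
      have := (hasManyProducts_triple hcen hinj (Nat.card φ.ker) (hT a (by simp))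
        (hT b (by simp)) (hT' a b (Multiset.le_add_right _ _)) hh hh1).add hφ
        (ih (T := T') (K := K') (fun g hg ↦ hT g (by simp [hg]))
          (fun a b hab ↦ hT' a b (hab.trans (Multiset.le_add_left _ _)))
          (fun h hh ↦ hK h (by simp [hh])) (by omega) (by omega))
      rwa [show 2 + 2 * (0 + n) = 2 * (0 + (n + 1)) by ring,
        show {a, b, h} + (T' + K') = {a, b} + T' + ({h} + K') by
          simp only [Multiset.insert_eq_cons, ← Multiset.singleton_add]; abel] at this
  | succ m ih =>
    obtain ⟨C, T', rfl, hC⟩ := Multiset.exists_eq_add_of_le_card (K := T) (k := 1) (by omega)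
    obtain ⟨D, K', rfl, hD⟩ := Multiset.exists_eq_add_of_le_card (K := K) (k := 2) (by omega)
    obtain ⟨g, rfl⟩ := Multiset.card_eq_one.1 hC
    simp only [Multiset.card_add, hC, hD] at h₁ h₂
    have := (hasManyProducts_cons hH hcen hcomm (Nat.card φ.ker) (hT g (by simp))
      D (fun h hh ↦ hK h (by simp [hh])) (by omega)).add hφ
      (ih (T := T') (K := K') (fun g hg ↦ hT g (by simp [hg]))
        (fun a b hab ↦ hT' a b (hab.trans (Multiset.le_add_left _ _)))
        (fun h hh ↦ hK h (by simp [hh])) (by omega) (by omega))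
    rwa [hD, show 2 + 2 * (m + n) = 2 * (m + 1 + n) by ring,
      show g ::ₘ D + (T' + K') = {g} + T' + (D + K') by
        simp only [← Multiset.singleton_add]; abel] at this

lemma exists_infix_prod_eq_one {l : List G} (hl : ∀ h ∈ l, h ∈ H) (hlen : Nat.card H ≤ l.length) :
    ∃ l₁ l₂ l₃, l = l₁ ++ l₂ ++ l₃ ∧ l₂ ≠ [] ∧ l₂.prod = 1 ∧ l₂.length ≤ Nat.card H := by
  have hmem (i : ℕ) : (l.take i).prod ∈ H :=
    H.list_prod_mem fun x hx ↦ hl x (List.mem_of_mem_take hx)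
  obtain ⟨i, j, hij, heq⟩ : ∃ i j : Fin (Nat.card H + 1), i < j ∧
      (l.take i).prod = (l.take j).prod := by
    have : Fintype H := Fintype.ofFinite H
    obtain ⟨i, j, hne, h⟩ := Fintype.exists_ne_map_eq_of_card_lt
      (fun i : Fin (Nat.card H + 1) ↦ (⟨(l.take i).prod, hmem i⟩ : H))
      (by rw [Fintype.card_fin, ← Nat.card_eq_fintype_card]; omega)
    have h : (l.take i).prod = (l.take j).prod := congrArg Subtype.val h
    rcases lt_or_gt_of_ne hne with h' | h'
    · exact ⟨i, j, h', h⟩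
    · exact ⟨j, i, h', h.symm⟩
  have hij' : (i : ℕ) < j := hij
  have hj := j.2
  have htake : l.take i ++ (l.take j).drop i = l.take j := by
    conv_rhs => rw [← List.take_append_drop i (l.take j), List.take_take, min_eq_left hij'.le]
  refine ⟨l.take i, (l.take j).drop i, l.drop j, ?_, ?_, ?_, ?_⟩
  · rw [htake, List.take_append_drop]
  · rw [← List.length_pos_iff, List.length_drop, List.length_take]
    omega
  · rw [← htake, List.prod_append] at heq
    simpa using heq
  · rw [List.length_drop, List.length_take]
    omega

/-- A list all of whose infixes with terms satisfying `P` are shorter than `p` has bounded length. -/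
lemma List.length_le_of_forall_infix_lt {α : Type*} (P : α → Bool) {p : ℕ} {l : List α}
    (hl : ∀ l', l' <:+: l → (∀ x ∈ l', P x) → l'.length < p) :
    l.length ≤ (l.takeWhile P).length + l.countP (fun x ↦ !P x) * p := by
  induction l with
  | nil => simp
  | cons a l ih =>
    have ih := ih fun l' h ↦ hl l' (h.trans (List.suffix_cons a l).isInfix)
    by_cases ha : P a
    · simp only [List.length_cons, List.takeWhile_cons, ha, if_true, List.countP_cons]
      simp
      omega
    · have := hl (l.takeWhile P)
        (.trans ⟨[], l.dropWhile P, by simp⟩ (List.suffix_cons a l).isInfix)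
        (fun x hx ↦ List.mem_takeWhile_imp hx)
      simp only [List.length_cons, List.takeWhile_cons, ha, List.countP_cons]
      simp [add_mul]
      omega

lemma IsMinimalProductOne.not_hasManyProducts {S W R : Multiset G} (hS : IsMinimalProductOne S)
    (h : S = W + R) (hW : W ≠ 0) (hW' : IsProductOne W) (hR : R ≠ 0) :
    ¬ HasManyProducts (Nat.card φ.ker) R (Nat.card φ.ker - 1) := by
  refine fun hR' ↦ hS.2.2 ⟨W, R, hW, hR, h, hW', hR'.isProductOne ?_⟩
  have := map_prod_eq_one φ hS.2.1
  rwa [h, Multiset.map_add, Multiset.prod_add, map_prod_eq_one φ hW', one_mul] at this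

open scoped Classical in
lemma IsMinimalProductOne.card_lt {S : Multiset G} (hS : IsMinimalProductOne S)
    (hcard : Nat.card H < S.card) :
    S.card < (S.filter (fun g ↦ g ∉ H)).card * Nat.card H + Nat.card H := by
  obtain ⟨-, ⟨l, rfl, hl⟩, hmin⟩ := hS
  have key : ∀ l', l' <:+: l → (∀ x ∈ l', decide (x ∈ H)) → l'.length < Nat.card H := by
    rintro _ ⟨s, t, rfl⟩ hl'
    by_contra! hlen
    obtain ⟨l₁, l₂, l₃, rfl, hne, hprod, hle⟩ :=
      exists_infix_prod_eq_one (fun h hh ↦ of_decide_eq_true (hl' h hh)) hlen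
    refine hmin ⟨l₂, ↑(s ++ l₁ ++ l₃ ++ t), by simpa using hne, ?_, ?_, ⟨l₂, rfl, hprod⟩, _, rfl, ?_⟩
    · rw [← Multiset.card_pos]
      simp only [Multiset.coe_card, List.length_append] at hcard ⊢
      omega
    · simp only [← Multiset.coe_add]
      abel
    · simpa [mul_assoc, hprod] using hl
  have h := List.length_le_of_forall_infix_lt _ key
  have h' := key (l.takeWhile fun x ↦ decide (x ∈ H))
    ⟨[], l.dropWhile fun x ↦ decide (x ∈ H), by simp⟩
    (fun x hx ↦ List.mem_takeWhile_imp (p := fun x ↦ decide (x ∈ H)) hx)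
  have hc : ((l : Multiset G).filter (fun g ↦ g ∉ H)).card
      = l.countP (fun x ↦ !decide (x ∈ H)) := by
    rw [← Multiset.countP_eq_card_filter, Multiset.coe_countP]
    congr 1
    ext x
    simp
  rw [hc, Multiset.coe_card]
  omega

open scoped Classical in
theorem IsMinimalProductOne.card_filter_mem_le (hφ : (Nat.card φ.ker).Prime)
    (hφ' : Odd (Nat.card φ.ker)) (hH : (Nat.card H).Prime) (hH3 : 3 ≤ Nat.card H)
    (hle : 2 * Nat.card H + 1 ≤ Nat.card φ.ker)
    (hcen : ∀ h ∈ H, h ≠ 1 → ∀ g, g * h = h * g → g ∈ H)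
    (hinj : ∀ h ∈ H, φ h = 1 → h = 1) {S : Multiset G} (hS : IsMinimalProductOne S)
    (hlen : 2 * Nat.card φ.ker + 1 ≤ S.card) :
    (S.filter (fun g ↦ g ∈ H)).card ≤ Nat.card φ.ker := by
  by_contra! hgt
  have hcomm : ∀ a ∈ H, ∀ b ∈ H, a * b = b * a := fun a ha b hb ↦ by
    rw [← mul_inv_eq_one]
    refine hinj _ (H.mul_mem (H.mul_mem ha hb) (H.inv_mem (H.mul_mem hb ha))) ?_
    rw [map_mul, map_inv, map_mul, map_mul, mul_comm (φ b), mul_inv_cancel]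
  have hbound := hS.card_lt (H := H) (by omega)
  have hone := hS.one_notMem (by omega)
  have hsum : S.filter (fun g ↦ g ∈ H) + S.filter (fun g ↦ g ∉ H) = S := Multiset.filter_add_not _ _
  have hK : ∀ h ∈ S.filter (fun g ↦ g ∈ H), h ∈ H ∧ h ≠ 1 := fun h hh ↦
    ⟨(Multiset.mem_filter.1 hh).2, fun e ↦ hone (e ▸ (Multiset.mem_filter.1 hh).1)⟩
  have hT : ∀ g ∈ S.filter (fun g ↦ g ∉ H), g ∉ H := fun g hg ↦ (Multiset.mem_filter.1 hg).2
  generalize S.filter (fun g ↦ g ∈ H) = K at *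
  generalize S.filter (fun g ↦ g ∉ H) = T at *
  have hcard : K.card + T.card = S.card := by rw [← hsum, Multiset.card_add]
  obtain ⟨W, K', rfl, hW, hW', hWp⟩ : ∃ W K', K = W + K' ∧ W ≠ 0 ∧ IsProductOne W ∧
      W.card ≤ Nat.card H := by
    obtain ⟨l₁, l₂, l₃, heq, hne, hprod, hp⟩ := exists_infix_prod_eq_one (H := H) (l := K.toList)
      (fun h hh ↦ (hK h (Multiset.mem_toList.1 hh)).1) (by rw [Multiset.length_toList]; omega)
    refine ⟨l₂, ↑(l₁ ++ l₃), ?_, by simpa using hne, ⟨l₂, rfl, hprod⟩, by simpa using hp⟩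
    rw [← K.coe_toList, heq]
    simp only [← Multiset.coe_add]
    abel
  have hW0 : 0 < W.card := Multiset.card_pos.2 hW
  rw [Multiset.card_add] at hgt hcard
  have hK' : ∀ h ∈ K', h ∈ H ∧ h ≠ 1 := fun h hh ↦ hK h (by simp [hh])
  have hR : T + K' ≠ 0 := by
    rw [← Multiset.card_pos, Multiset.card_add]
    omega
  obtain ⟨m, hm⟩ := hφ'
  have hmul : T.card * (Nat.card H - 1) = T.card * Nat.card H - T.card := by
    rw [Nat.mul_sub, mul_one]
  rcases le_or_gt T.card (m + 1) with hTm | hTm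
  · refine hS.not_hasManyProducts (φ := φ) (by rw [← hsum]; abel) hW hW' hR
      (hasManyProducts_of_le_mul hφ hH hcen hcomm hT hK' ?_ ?_) <;> omega
  by_cases hpair : ∃ a b, {a, b} ≤ T ∧ a * b = 1
  · obtain ⟨a, b, hab, hab1⟩ := hpair
    obtain ⟨T', rfl⟩ := Multiset.le_iff_exists_add.1 hab
    have hc : ({a, b} + T' : Multiset G).card = 2 + T'.card := by
      rw [Multiset.card_add, Multiset.card_pair]
    refine hS.not_hasManyProducts (φ := φ) (W := {a, b}) (R := T' + (W + K'))
      (by rw [← hsum]; abel) (by simp) ⟨[a, b], rfl, by simpa using hab1⟩ ?_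
      (hasManyProducts_of_le_mul hφ hH hcen hcomm (fun g hg ↦ hT g (by simp [hg])) hK ?_ ?_)
    · rw [← Multiset.card_pos, Multiset.card_add, Multiset.card_add]
      omega
    · rw [Multiset.card_add]
      omega
    · calc Nat.card φ.ker - 1 ≤ T'.card * 2 := by omega
        _ ≤ _ := Nat.mul_le_mul_left _ (by omega)
  · push Not at hpair
    have := hasManyProducts_of_triples hφ hH hH3 hcen hcomm hinj hT hpair hK'
      (m := m - min m (T.card - m)) (n := min m (T.card - m)) (by omega) (by omega)
    refine hS.not_hasManyProducts (φ := φ) (by rw [← hsum]; abel) hW hW' hR ?_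
    convert this using 1
    omega

end ProdSet

/-- In a non-abelian group of order `p * q`, the nontrivial elements of a subgroup of order `p`
have their centralizers contained in that subgroup. -/
lemma mem_of_commute_of_card_eq_mul {p q : ℕ} (hp : p.Prime) (hq : q.Prime) {G : Type*} [Group G]
    [Finite G] (hG : Nat.card G = p * q) (hna : ¬ ∀ a b : G, a * b = b * a) {H : Subgroup G}
    (hH : Nat.card H = p) (hcomm : ∀ a ∈ H, ∀ b ∈ H, a * b = b * a) {h : G} (hh : h ∈ H)
    (hh1 : h ≠ 1) {g : G} (hg : g * h = h * g) : g ∈ H := by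
  have hle : H ≤ Subgroup.centralizer {h} := fun x hx ↦
    Subgroup.mem_centralizer_singleton_iff.2 (hcomm x hx h hh)
  obtain ⟨d, hd⟩ := Subgroup.card_dvd_of_le hle
  have hdvd : d ∣ q := by
    have := Subgroup.card_subgroup_dvd_card (Subgroup.centralizer {h})
    rw [hd, hG, hH] at this
    exact Nat.dvd_of_mul_dvd_mul_left hp.pos this
  rcases (Nat.dvd_prime hq).1 hdvd with rfl | rfl
  · rw [mul_one] at hd
    rw [Subgroup.eq_of_le_of_card_ge hle hd.le]
    exact Subgroup.mem_centralizer_singleton_iff.2 hg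
  · refine absurd ?_ hna
    have htop : Subgroup.centralizer {h} = ⊤ := Subgroup.eq_top_of_card_eq _ (by rw [hd, hG, hH])
    have hcenter : h ∈ Subgroup.center G := Subgroup.mem_center_iff.2 fun x ↦
      Subgroup.mem_centralizer_singleton_iff.1 (htop ▸ Subgroup.mem_top x)
    have horder : orderOf h = p := by
      have := (Nat.dvd_prime hp).1 (hH ▸ Subgroup.orderOf_dvd_natCard H hh)
      exact this.resolve_left (by rwa [orderOf_eq_one_iff])
    have hdvd' : p ∣ Nat.card (Subgroup.center G) := horder ▸ Subgroup.orderOf_dvd_natCard _ hcenter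
    have hquot : Nat.card (G ⧸ Subgroup.center G) ∣ d := by
      obtain ⟨e, he⟩ := hdvd'
      have := Subgroup.card_eq_card_quotient_mul_card_subgroup (Subgroup.center G)
      rw [hG, he, mul_left_comm] at this
      exact ⟨e, Nat.eq_of_mul_eq_mul_left hp.pos this⟩
    have : IsCyclic (G ⧸ Subgroup.center G) := by
      rcases (Nat.dvd_prime hq).1 hquot with h1 | h1
      · have := (Nat.card_eq_one_iff_unique.1 h1).1
        infer_instance
      · have := Fact.mk hq
        exact isCyclic_of_prime_card h1
    exact ((QuotientGroup.mk' (Subgroup.center G)).isMulCommutative_of_isCyclic_of_ker_le_center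
      (by simp)).is_comm.comm

lemma exists_monoidHom_card_ker {p q : ℕ} (hp : p.Prime) (hq : q.Prime) (hpq : p < q) (G : Type*)
    [Group G] [Finite G] (hG : Nat.card G = p * q) :
    ∃ φ : G →* Multiplicative (ZMod p), Nat.card φ.ker = q := by
  have := Fact.mk hp
  have := Fact.mk hq
  obtain ⟨N, hN⟩ := Sylow.exists_subgroup_card_pow_prime q (n := 1) (G := G)
    (by rw [pow_one, hG]; exact dvd_mul_left q p)
  rw [pow_one] at hN
  have hindex : N.index = p := by
    have := N.card_mul_index
    rw [hN, hG, mul_comm p] at this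
    exact Nat.eq_of_mul_eq_mul_left hq.pos this
  have hnormal : N.Normal := by
    refine Subgroup.normal_of_index_eq_minFac_card ?_
    have hr : (p * q).minFac.Prime := Nat.minFac_prime (by
      have := Nat.mul_le_mul hp.two_le hq.two_le
      omega)
    have hle : (p * q).minFac ≤ p := Nat.minFac_le_of_dvd hp.two_le (dvd_mul_right p q)
    rw [hindex, hG]
    rcases (hr.dvd_mul).1 (Nat.minFac_dvd (p * q)) with h | h
    · exact ((Nat.prime_dvd_prime_iff_eq hr hp).1 h).symm
    · have := (Nat.prime_dvd_prime_iff_eq hr hq).1 h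
      omega
  let e : G ⧸ N ≃* Multiplicative (ZMod p) :=
    mulEquivOfPrimeCardEq (p := p) hindex (by simp)
  refine ⟨(e : G ⧸ N →* Multiplicative (ZMod p)).comp (QuotientGroup.mk' N), ?_⟩
  rw [MonoidHom.ker_mulEquiv_comp, QuotientGroup.ker_mk', hN]

open scoped Classical in
theorem stmt15 (p q : ℕ) (hp : p.Prime) (hq : q.Prime) (hpodd : Odd p)
    (hqodd : Odd q) (hpq : p ∣ q - 1)
    (G : Type*) [Group G] [Finite G] (hG : Nat.card G = p * q)
    (hna : ¬ ∀ a b : G, a * b = b * a)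
    (S : Multiset G) (hS : IsMinimalProductOne S)
    (hlen : 2 * q + 1 ≤ Multiset.card S) :
    ∀ H : Subgroup G, Nat.card H = p →
      Multiset.card (S.filter (fun g => g ∈ H)) ≤ q := by
  intro H hH
  have := Fact.mk hp
  have hp3 : 3 ≤ p := by
    have := hp.two_le
    obtain ⟨k, rfl⟩ := hpodd
    omega
  have hle : 2 * p + 1 ≤ q := by
    obtain ⟨k, rfl⟩ := hqodd
    have hk : p ∣ k := by
      rw [Nat.add_sub_cancel, Nat.Coprime.dvd_mul_left] at hpq
      · exact hpq
      · exact (Nat.coprime_two_right).2 hpodd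
    have hk0 : 0 < k := by
      rcases Nat.eq_zero_or_pos k with rfl | h
      · exact absurd hq (by norm_num)
      · exact h
    have := Nat.le_of_dvd hk0 hk
    omega
  obtain ⟨φ, rfl⟩ := exists_monoidHom_card_ker hp hq (by omega) G hG
  have hcomm : ∀ a ∈ H, ∀ b ∈ H, a * b = b * a := fun a ha b hb ↦ by
    have := isCyclic_of_prime_card hH
    let _ : CommGroup H := IsCyclic.commGroup
    exact congrArg Subtype.val (mul_comm (⟨a, ha⟩ : H) ⟨b, hb⟩)
  refine hS.card_filter_mem_le hq hqodd (hH ▸ hp) (hH ▸ hp3) (hH ▸ hle)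
    (fun h hh hh1 g ↦ mem_of_commute_of_card_eq_mul hp hq hG hna hH hcomm hh hh1) ?_ hlen
  intro h hh hker
  have hcop : Nat.Coprime p (Nat.card φ.ker) := (Nat.coprime_primes hp hq).2 (by omega)
  have h₁ : orderOf h ∣ p := hH ▸ Subgroup.orderOf_dvd_natCard H hh
  have h₂ : orderOf h ∣ Nat.card φ.ker := Subgroup.orderOf_dvd_natCard _ hker
  exact orderOf_eq_one_iff.1 (Nat.eq_one_of_dvd_coprimes hcop h₁ h₂)
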